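/- Let q ≥ 5 be a prime power, F_q the finite field with q elements, k a positive divisor of q-1 with k ≥ 2, and f(x) = ax² + bx + c ∈ F_q[x] a quadratic polynomial (a ≠ 0) with b² - 4ac ≠ 0. Let t be a positive divisor of q-1 and let p be a prime dividing q-1 but not dividing t. Then | N(p t, k) - (1 - 1/p) N(t, k) | ≤ (φ(p t)/(p t)) · 2 W(t) q^{1/2}, where φ is Euler's totient function. -/

import Mathlib

open scoped Classical

/-- `g` is a primitive element of the finite field `F`, i.e. a generator of `Fˣ`. -/
def IsPrimitiveElement {F : Type*} [Field F] [Fintype F] (g : F) : Prop :=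
  ∀ y : F, y ≠ 0 → ∃ n : ℕ, g ^ n = y

/-- `x` is `t`-free: `x ≠ 0` and `x = y ^ d` with `d ∣ t`, `d > 0` forces `d = 1`. -/
def IsTFree {F : Type*} [Field F] (t : ℕ) (x : F) : Prop :=
  x ≠ 0 ∧ ∀ d : ℕ, 0 < d → d ∣ t → (∃ y : F, y ^ d = x) → d = 1

/-- `N(t, k)`: the number of `t`-free `x ∈ F` with `f(x) = a x² + b x + c` a nonzero
`k`-th power. -/
noncomputable def Ncount (F : Type*) [Field F] [Fintype F] (a b c : F) (t k : ℕ) : ℕ :=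
  Nat.card {x : F | IsTFree t x ∧ ∃ y : F, y ≠ 0 ∧ y ^ k = a * x ^ 2 + b * x + c}

/-- `W(n)`: the number of squarefree positive divisors of `n`. -/
noncomputable def Wnum (n : ℕ) : ℕ := (n.divisors.filter Squarefree).card

/-- `Rad(n)`: the product of the distinct primes dividing `n`. -/
noncomputable def rad (n : ℕ) : ℕ := ∏ p ∈ n.primeFactors, p

section PolynomialPart

open Polynomial

theorem forall_eq_zero_of_sum_mul_X_sub_C_pow_eq_zero {K ι : Type*} [Field K] [Fintype ι]
    {T : ℕ} {ρ : K} {t V : ι → K[X]} {m : ι → ℕ}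
    (ht : ∀ i, (t i).degree < T) (hV : ∀ i, (V i).eval ρ ≠ 0)
    (hm : ∀ i j, i ≠ j → m i ≤ m j → m i + T ≤ m j)
    (h : ∑ i, t i * ((X - C ρ) ^ m i * V i) = 0) (i : ι) : t i = 0 := by
  classical
  by_contra hi
  obtain ⟨i₀, hi₀, hmin⟩ := Finset.exists_min_image (Finset.univ.filter fun i => t i ≠ 0) m
    ⟨i, by simpa using hi⟩
  have hi₀' : t i₀ ≠ 0 := by simpa using hi₀
  have hdvd : (X - C ρ) ^ (m i₀ + T) ∣ t i₀ * ((X - C ρ) ^ m i₀ * V i₀) := by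
    have h1 : t i₀ * ((X - C ρ) ^ m i₀ * V i₀)
        = -∑ j ∈ Finset.univ.erase i₀, t j * ((X - C ρ) ^ m j * V j) := by
      rw [← Finset.add_sum_erase _ _ (Finset.mem_univ i₀)] at h
      exact eq_neg_of_add_eq_zero_left h
    rw [h1, dvd_neg]
    refine Finset.dvd_sum fun j hj => ?_
    by_cases hj0 : t j = 0
    · simp [hj0]
    · have := hm i₀ j (Finset.ne_of_mem_erase hj).symm (hmin j (by simpa using hj0))
      exact dvd_mul_of_dvd_right (dvd_mul_of_dvd_left (pow_dvd_pow _ this) _) _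
  have hdvd' : (X - C ρ) ^ T ∣ t i₀ * V i₀ := by
    rw [pow_add, mul_left_comm] at hdvd
    exact (mul_dvd_mul_iff_left (pow_ne_zero _ (X_sub_C_ne_zero ρ))).1 hdvd
  have hcop : IsCoprime ((X - C ρ) ^ T) (V i₀) := by
    refine IsCoprime.pow_left ((irreducible_X_sub_C ρ).coprime_iff_not_dvd.2 ?_)
    rw [dvd_iff_isRoot]
    exact hV i₀
  have h3 := degree_le_of_dvd (hcop.dvd_of_dvd_mul_right hdvd') hi₀'
  rw [degree_pow, degree_X_sub_C] at h3
  have h4 := ht i₀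
  simp only [nsmul_eq_mul, mul_one] at h3
  exact absurd (lt_of_le_of_lt h3 h4) (lt_irrefl _)

theorem exists_sum_smul_eq_zero_of_degree_lt {K ι : Type*} [Field K] [Fintype ι] {N : ℕ}
    {e : ι → K[X]} (he : ∀ i, (e i).degree < N) (hN : N < Fintype.card ι) :
    ∃ u : ι → K, ∑ i, u i • e i = 0 ∧ ∃ i, u i ≠ 0 := by
  rw [← Fintype.not_linearIndependent_iff]
  intro hli
  have h2 : LinearIndependent K
      (fun i => (⟨e i, mem_degreeLT.2 (he i)⟩ : degreeLT K N)) :=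
    LinearIndependent.of_comp (degreeLT K N).subtype hli
  have := h2.fintype_card_le_finrank
  rw [Module.finrank_eq_card_basis (degreeLT.basis K N), Fintype.card_fin] at this
  omega

/-- The Stepanov–Bombieri bound. -/
theorem card_le_of_pow_eq_of_eval_pow_eq {K : Type*} [Field K] [IsAlgClosed K] (p : ℕ)
    [Fact p.Prime] [CharP K p] {s P n T D : ℕ} (hPs : P = p ^ s) (hP : P = n * T + 1)
    (hn : 0 < n) (hT : 0 < T)
    {G : K[X]} (hD : G.natDegree ≤ D) (hPD : D + 3 ≤ P) {ρ : K} (hρ : G.IsRoot ρ)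
    (hρ' : G.derivative.eval ρ ≠ 0) {η ζ : K} (hζ : ζ ≠ 0) {Z : Finset K}
    (hZ : ∀ y ∈ Z, y ^ (P ^ 2) = η * y) (hGZ : ∀ y ∈ Z, G.eval y ^ ((P + 1) * T) = ζ) :
    Z.card ≤ T * P + (2 * D + 3) * P := by
  classical
  have hP0 : 0 < P := by omega
  have sum_pow_P : ∀ {ι : Type} (S : Finset ι) (f : ι → K),
      (∑ i ∈ S, f i) ^ P = ∑ i ∈ S, f i ^ P := fun S f => by
    rw [hPs]; exact sum_pow_char_pow p s S f
  have sub_pow_P : ∀ x y : K, (x - y) ^ P = x ^ P - y ^ P := fun x y => by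
    rw [hPs]; exact sub_pow_char_pow x y s
  obtain ⟨G₁, hG₁⟩ := dvd_iff_isRoot.2 hρ
  have hG₁ρ : G₁.eval ρ ≠ 0 := by
    rw [hG₁] at hρ'
    simpa [derivative_mul] using hρ'
  set A := T + D + 3 with hA
  let e : (Fin A × Fin n) × Fin T → K[X] := fun i =>
    C (ζ ^ (i.1.2 : ℕ)) * X ^ ((i.2 : ℕ) * P) * (C η * X - C (ρ ^ (P ^ 2))) ^ (i.1.1 : ℕ)
      * G ^ ((n - 1 - i.1.2) * T)
  set N := (T - 1) * P + A + (n - 1) * T * D with hN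
  have he : ∀ i, (e i).degree < N := by
    rintro ⟨⟨a, b⟩, j⟩
    refine lt_of_le_of_lt degree_le_natDegree (Nat.cast_lt.2 ?_)
    have h1 : (e ⟨⟨a, b⟩, j⟩).natDegree ≤ 0 + j * P + a * 1 + (n - 1 - b) * T * D := by
      refine natDegree_mul_le_of_le (natDegree_mul_le_of_le (natDegree_mul_le_of_le
        (natDegree_C _).le (natDegree_X_pow_le _)) (natDegree_pow_le_of_le _ ?_))
        (natDegree_pow_le_of_le _ hD)
      compute_degree
    have h2 : (j : ℕ) * P ≤ (T - 1) * P := Nat.mul_le_mul_right _ (by omega)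
    have h3 : (n - 1 - b) * T * D ≤ (n - 1) * T * D :=
      Nat.mul_le_mul_right _ (Nat.mul_le_mul_right _ (by omega))
    have := a.2
    omega
  have hcard : N < Fintype.card ((Fin A × Fin n) × Fin T) := by
    simp only [Fintype.card_prod, Fintype.card_fin]
    obtain ⟨n', rfl⟩ : ∃ n', n = n' + 1 := ⟨n - 1, by omega⟩
    obtain ⟨T', rfl⟩ : ∃ T', T = T' + 1 := ⟨T - 1, by omega⟩
    simp only [Nat.add_sub_cancel] at hN
    rw [hN, hA]
    have : (n' * (T' + 1)) * D ≤ P * D := Nat.mul_le_mul_right _ (by rw [hP]; ring_nf; omega)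
    have h5 : (T' + 1 + D + 3) * (n' + 1) * (T' + 1) + (T' + 1 + D + 3) = (T' + 1 + D + 3) * P := by
      rw [hP]; ring
    have h6 : T' + 1 + 1 ≤ P := by rw [hP]; nlinarith
    nlinarith
  obtain ⟨u, hu, i₀, hi₀⟩ := exists_sum_smul_eq_zero_of_degree_lt he hcard
  choose w hw using fun i => IsAlgClosed.exists_pow_nat_eq (u i) hP0
  let t : Fin A × Fin n → K[X] := fun ab => ∑ j : Fin T, C (w (ab, j)) * X ^ (j : ℕ)
  let h : K[X] := ∑ ab : Fin A × Fin n,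
    t ab * ((X - C ρ) ^ ((ab.1 : ℕ) * P + ab.2 * T) * G₁ ^ ((ab.2 : ℕ) * T))
  have htdeg : ∀ ab, (t ab).degree < T := fun ab => by
    refine (degree_sum_le _ _).trans_lt ((Finset.sup_lt_iff (WithBot.bot_lt_coe T)).2 ?_)
    intro j _
    exact (degree_C_mul_X_pow_le _ _).trans_lt (Nat.cast_lt.2 j.2)
  have hh0 : h ≠ 0 := by
    intro h0
    have ht0 := forall_eq_zero_of_sum_mul_X_sub_C_pow_eq_zero (t := t)
      (V := fun ab => G₁ ^ ((ab.2 : ℕ) * T)) (m := fun ab => (ab.1 : ℕ) * P + ab.2 * T)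
      htdeg (fun ab => by rw [eval_pow]; exact pow_ne_zero _ hG₁ρ) ?_ h0 i₀.1
    · have h1 := congrArg (fun r => r.coeff (i₀.2 : ℕ)) ht0
      have h2 : w i₀ = 0 := by
        simpa [t, finsetSum_coeff, coeff_X_pow, Fin.val_inj] using h1
      apply hi₀
      rw [← hw, h2, zero_pow hP0.ne']
    · rintro ⟨a, b⟩ ⟨a', b'⟩ hne hle
      simp only at hle ⊢
      have hb := b.2
      have hb' := b'.2
      rcases lt_trichotomy (a : ℕ) a' with haa | haa | haa
      · obtain ⟨d, hd⟩ := Nat.exists_eq_add_of_lt haa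
        rw [hd]
        have : ((b : ℕ) + 1) * T ≤ n * T := Nat.mul_le_mul_right _ hb
        nlinarith
      · rw [haa] at hle ⊢
        have hlt : (b : ℕ) < b' := by
          refine lt_of_le_of_ne ?_ fun hbb => hne ?_
          · by_contra hc
            push Not at hc
            have := Nat.mul_lt_mul_of_pos_right hc hT
            omega
          · exact Prod.ext (Fin.ext haa) (Fin.ext hbb)
        have : ((b : ℕ) + 1) * T ≤ b' * T := Nat.mul_le_mul_right _ hlt
        nlinarith
      · exfalso
        obtain ⟨d, hd⟩ := Nat.exists_eq_add_of_lt haa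
        rw [hd] at hle
        have : ((b' : ℕ) + 1) * T ≤ n * T := Nat.mul_le_mul_right _ hb'
        nlinarith
  have hhG : h = ∑ ab : Fin A × Fin n,
      t ab * ((X - C ρ) ^ ((ab.1 : ℕ) * P) * G ^ ((ab.2 : ℕ) * T)) := by
    refine Finset.sum_congr rfl fun ab _ => ?_
    rw [hG₁, mul_pow, pow_add]
    ring
  have hroot : ∀ y ∈ Z, h.IsRoot y := by
    intro y hy
    have hG0 : G.eval y ≠ 0 := by
      intro h0
      apply hζ
      rw [← hGZ y hy, h0, zero_pow]
      positivity
    have hE : (∑ i, u i • e i).eval y = 0 := by rw [hu, eval_zero]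
    have key : (h.eval y) ^ P * (G.eval y) ^ ((n - 1) * T) = (∑ i, u i • e i).eval y := by
      rw [hhG, eval_finsetSum, eval_finsetSum, sum_pow_P, Finset.sum_mul,
        Fintype.sum_prod_type (f := fun i => (u i • e i).eval y)]
      refine Finset.sum_congr rfl fun ab _ => ?_
      simp only [t, eval_mul, eval_finsetSum, mul_pow, sum_pow_P, Finset.sum_mul]
      refine Finset.sum_congr rfl fun j _ => ?_
      simp only [e, eval_mul, eval_pow, eval_sub, eval_C, eval_X, eval_smul, smul_eq_mul]
      have h1 : ((y - ρ) ^ ((ab.1 : ℕ) * P)) ^ P = (η * y - ρ ^ (P ^ 2)) ^ (ab.1 : ℕ) := by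
        rw [← hZ y hy, sq, pow_mul y, pow_mul ρ, ← sub_pow_P, ← sub_pow_P, ← pow_mul, ← pow_mul,
          ← pow_mul]
        congr 1; ring
      have h2 : (G.eval y ^ ((ab.2 : ℕ) * T)) ^ P * G.eval y ^ ((n - 1) * T)
          = ζ ^ (ab.2 : ℕ) * G.eval y ^ ((n - 1 - ab.2) * T) := by
        rw [← hGZ y hy, ← pow_mul, ← pow_mul, ← pow_add, ← pow_add]
        congr 1
        obtain ⟨d, hd⟩ : ∃ d, n - 1 = ab.2 + d := ⟨n - 1 - ab.2, by have := ab.2.2; omega⟩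
        rw [hd, Nat.add_sub_cancel_left]
        ring
      rw [hw, h1, mul_assoc, mul_assoc _ _ (G.eval y ^ _), h2, pow_mul y]
      ring
    rw [hE] at key
    exact pow_eq_zero_iff hP0.ne' |>.1 ((mul_eq_zero.1 key).resolve_right (pow_ne_zero _ hG0))
  have hdeg : h.natDegree ≤ T * P + (2 * D + 3) * P := by
    rw [hhG]
    refine natDegree_sum_le_of_forall_le _ _ fun ab _ => ?_
    have h1 : (t ab * ((X - C ρ) ^ ((ab.1 : ℕ) * P) * G ^ ((ab.2 : ℕ) * T))).natDegree
        ≤ T + ((ab.1 : ℕ) * P * 1 + (ab.2 : ℕ) * T * D) :=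
      natDegree_mul_le_of_le (natDegree_le_of_degree_le (htdeg ab).le)
        (natDegree_mul_le_of_le (natDegree_pow_le_of_le _ (natDegree_X_sub_C_le _))
          (natDegree_pow_le_of_le _ hD))
    have h2 : (ab.1 : ℕ) * P ≤ (T + D + 2) * P := Nat.mul_le_mul_right _ (by omega)
    have h3 : (ab.2 : ℕ) * T * D ≤ n * T * D :=
      Nat.mul_le_mul_right _ (Nat.mul_le_mul_right _ ab.2.2.le)
    have h4 : n * T * D ≤ P * D := Nat.mul_le_mul_right _ (by omega)
    have h5 : T ≤ P := by nlinarith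
    nlinarith
  calc Z.card ≤ h.roots.toFinset.card := Finset.card_le_card fun y hy => by
        rw [Multiset.mem_toFinset, mem_roots hh0]; exact hroot y hy
    _ ≤ h.natDegree := (Multiset.toFinset_card_le _).trans (card_roots' h)
    _ ≤ _ := hdeg

theorem card_toFinset_nthRoots {K : Type*} [Field K] [IsAlgClosed K] [DecidableEq K] {n : ℕ}
    (hn : (n : K) ≠ 0) {a : K} (ha : a ≠ 0) : (nthRoots n a).toFinset.card = n := by
  have hn0 : 0 < n := Nat.pos_of_ne_zero fun h => hn (by simp [h])
  rw [nthRoots, Multiset.toFinset_card_of_nodup (nodup_roots (separable_X_pow_sub_C a hn ha)),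
    ← (IsAlgClosed.splits (X ^ n - C a)).natDegree_eq_card_roots, natDegree_X_pow_sub_C]

theorem card_norm_fiber_le {F E : Type*} [Field F] [Fintype F] [Field E] [Fintype E] [Algebra F E]
    [DecidableEq F] {s : ℕ} (hs : 2 ≤ s) (hq : 3 ≤ Fintype.card F)
    (hE : Fintype.card E = Fintype.card F ^ (2 * s)) {b c : F} (hc : c ≠ 0)
    (hbc : b ^ 2 - 4 * c ≠ 0) {η ζ : F} (hη : η ≠ 0) (hζ : ζ ≠ 0) :
    (Fintype.card F - 1) ^ 2 * (Finset.univ.filter fun x : E => Algebra.norm F x = η ∧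
        Algebra.norm F (x ^ 2 + algebraMap F E b * x + algebraMap F E c) = ζ).card
      ≤ Fintype.card F ^ (2 * s) + 7 * (Fintype.card F - 1) ^ 2 * Fintype.card F ^ s := by
  classical
  set q := Fintype.card F with hqdef
  obtain ⟨n, hn⟩ : ∃ n, q = n + 1 := ⟨q - 1, by omega⟩
  set P := q ^ s with hP
  have hPn : ∃ T, P = n * T + 1 := by
    obtain ⟨T, hT⟩ : q - 1 ∣ q ^ s - 1 ^ s := Nat.sub_dvd_pow_sub_pow q 1 s
    refine ⟨T, ?_⟩
    have : 0 < q ^ s := by positivity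
    rw [hn, Nat.add_sub_cancel, ← hn, one_pow] at hT
    omega
  obtain ⟨T, hT⟩ := hPn
  have hPq : q * 3 ≤ P := by
    calc q * 3 ≤ q * q := Nat.mul_le_mul_left _ hq
      _ = q ^ 2 := by ring
      _ ≤ P := Nat.pow_le_pow_right (by omega) hs
  have hT0 : 0 < T := by
    rcases Nat.eq_zero_or_pos T with h | h
    · rw [h] at hT; omega
    · exact h
  have hEP : Fintype.card E = P ^ 2 := by rw [hE, hP, ← pow_mul, mul_comm]
  have hM : (Nat.card E - 1) / (Nat.card F - 1) = (P + 1) * T := by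
    rw [Nat.card_eq_fintype_card, Nat.card_eq_fintype_card, hEP, ← hqdef, hn, hT,
      Nat.add_sub_cancel]
    refine Nat.div_eq_of_eq_mul_left (by omega) ?_
    rw [Nat.sub_eq_iff_eq_add (Nat.one_le_pow _ _ (by omega))]
    ring
  set p := ringChar F with hp
  have : Fact p.Prime := ⟨CharP.char_is_prime F p⟩
  obtain ⟨m, hpm⟩ := FiniteField.card F p
  let K := AlgebraicClosure E
  let i : F →+* K := (algebraMap E K).comp (algebraMap F E)
  have : CharP K p := charP_of_injective_ringHom i.injective p
  have hnK : (n : K) ≠ 0 := by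
    intro h
    have h1 : ((q : ℕ) : F) = 0 := by rw [hqdef]; exact FiniteField.cast_card_eq_zero F
    have h2 : i ((q : ℕ) : F) = 0 := by rw [h1, map_zero]
    rw [map_natCast, hn, Nat.cast_add, h, Nat.cast_one, zero_add] at h2
    exact one_ne_zero h2
  have hn0 : 0 < n := by omega
  obtain ⟨r, hr⟩ : ∃ r : K, r ^ 2 + i b * r + i c = 0 := by
    obtain ⟨r, hr⟩ := IsAlgClosed.exists_root (X ^ 2 + C (i b) * X + C (i c) : K[X]) (by
      have : (X ^ 2 + C (i b) * X + C (i c) : K[X]).degree = 2 := by compute_degree!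
      rw [this]; decide)
    exact ⟨r, by simpa using hr⟩
  have hr0 : r ≠ 0 := by
    rintro rfl
    simp at hr
    exact hc hr
  have hr2 : 2 * r + i b ≠ 0 := by
    intro h
    apply (_root_.map_ne_zero i).2 hbc
    rw [map_sub, map_pow, map_mul, map_ofNat]
    linear_combination (2 * r + i b) * h - 4 * hr
  obtain ⟨ρ, hρ⟩ := IsAlgClosed.exists_pow_nat_eq r hn0
  have hρ0 : ρ ≠ 0 := by
    rintro rfl
    rw [zero_pow hn0.ne'] at hρ
    exact hr0 hρ.symm
  let G : K[X] := (X ^ n) ^ 2 + C (i b) * X ^ n + C (i c)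
  have hGdeg : G.natDegree ≤ 2 * n := by
    have : (X ^ n) ^ 2 = (X ^ (2 * n) : K[X]) := by rw [← pow_mul, mul_comm]
    simp only [G, this]
    compute_degree
    omega
  have hGρ : G.IsRoot ρ := by simp [G, IsRoot, hρ, hr]
  have hGρ' : G.derivative.eval ρ ≠ 0 := by
    have : G.derivative.eval ρ = n * ρ ^ (n - 1) * (2 * r + i b) := by
      simp [G, derivative_pow, hρ]
      ring
    rw [this]
    exact mul_ne_zero (mul_ne_zero hnK (pow_ne_zero _ hρ0)) hr2
  set S := Finset.univ.filter fun x : E => Algebra.norm F x = η ∧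
        Algebra.norm F (x ^ 2 + algebraMap F E b * x + algebraMap F E c) = ζ with hS
  let Z : Finset K := S.biUnion fun x => (nthRoots n (algebraMap E K x)).toFinset
  have hZcard : Z.card = n * S.card := by
    rw [Finset.card_biUnion, Finset.sum_const_nat (m := n), mul_comm]
    · intro x hx
      refine card_toFinset_nthRoots hnK ((_root_.map_ne_zero _).2 ?_)
      rintro rfl
      rw [hS, Finset.mem_filter, Algebra.norm_zero] at hx
      exact hη hx.2.1.symm
    · intro x _ y _ hxy
      refine Finset.disjoint_left.2 fun z hz hz' => hxy ?_
      rw [Multiset.mem_toFinset, mem_nthRoots hn0] at hz hz'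
      exact (algebraMap E K).injective (hz.symm.trans hz')
  have hbound := card_le_of_pow_eq_of_eval_pow_eq p (s := m * s) (n := n) (T := T) (D := 2 * n)
    (P := P) (by rw [hP, hqdef, hpm.2, pow_mul]) hT hn0 hT0 hGdeg (by omega) hGρ hGρ'
    (η := i η) (ζ := i ζ) ((_root_.map_ne_zero i).2 hζ) (Z := Z) ?_ ?_
  · rw [hZcard] at hbound
    have hn1 : q - 1 = n := by omega
    rw [hn1]
    have h2 : q ^ (2 * s) = P * P := by rw [hP]; ring
    rw [h2]
    have h3 : n * (n * S.card) ≤ n * (T * P + (2 * (2 * n) + 3) * P) := Nat.mul_le_mul_left _ hbound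
    have h4 : n * (T * P) ≤ P * P := by
      rw [← mul_assoc]; exact Nat.mul_le_mul_right _ (by omega)
    have h5 : n * ((2 * (2 * n) + 3) * P) ≤ 7 * n ^ 2 * P := by
      rw [← mul_assoc]; exact Nat.mul_le_mul_right _ (by nlinarith)
    calc n ^ 2 * S.card = n * (n * S.card) := by ring
      _ ≤ n * (T * P) + n * ((2 * (2 * n) + 3) * P) := by rw [← mul_add]; exact h3
      _ ≤ _ := by omega
  · intro y hy
    obtain ⟨x, hx, hy⟩ := Finset.mem_biUnion.1 hy
    rw [Multiset.mem_toFinset, mem_nthRoots hn0] at hy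
    rw [hS, Finset.mem_filter] at hx
    have h1 : P ^ 2 = n * ((P + 1) * T) + 1 := by rw [hT]; ring
    rw [h1, pow_succ, pow_mul, hy, ← hM, ← map_pow, ← FiniteField.algebraMap_norm_eq_pow, hx.2.1]
    rfl
  · intro y hy
    obtain ⟨x, hx, hy⟩ := Finset.mem_biUnion.1 hy
    rw [Multiset.mem_toFinset, mem_nthRoots hn0] at hy
    rw [hS, Finset.mem_filter] at hx
    have h1 : G.eval y = algebraMap E K (x ^ 2 + algebraMap F E b * x + algebraMap F E c) := by
      simp [G, hy, i]
    rw [h1, ← hM, ← map_pow, ← FiniteField.algebraMap_norm_eq_pow, hx.2.2]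
    rfl

theorem norm_sum_mulChar_norm_le {F E : Type*} [Field F] [Fintype F] [Field E] [Fintype E]
    [Algebra F E] {s : ℕ} (hs : 2 ≤ s) (hq : 3 ≤ Fintype.card F)
    (hE : Fintype.card E = Fintype.card F ^ (2 * s)) {b c : F} (hc : c ≠ 0)
    (hbc : b ^ 2 - 4 * c ≠ 0) {χ : MulChar F ℂ} (hχ : χ ≠ 1) (ψ : MulChar F ℂ) :
    ‖∑ x : E, χ (Algebra.norm F x) *
        ψ (Algebra.norm F (x ^ 2 + algebraMap F E b * x + algebraMap F E c))‖
      ≤ (7 * (Fintype.card F : ℝ) ^ 2 + 3) * (Fintype.card F : ℝ) ^ s := by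
  classical
  set q := Fintype.card F with hqdef
  let f : E → E := fun x => x ^ 2 + algebraMap F E b * x + algebraMap F E c
  let N : Fˣ × Fˣ → ℕ := fun z => (Finset.univ.filter fun x : E => Algebra.norm F x = z.1 ∧
        Algebra.norm F (f x) = z.2).card
  set M : ℝ := ((q : ℝ) ^ (2 * s) + 7 * ((q : ℝ) - 1) ^ 2 * (q : ℝ) ^ s) / ((q : ℝ) - 1) ^ 2
    with hM
  have hq1 : (0 : ℝ) < (q : ℝ) - 1 := by
    have : (3 : ℝ) ≤ q := by exact_mod_cast hq
    linarith
  have hNM : ∀ z, (N z : ℝ) ≤ M := fun z => by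
    rw [hM, le_div_iff₀ (by positivity), mul_comm]
    have := card_norm_fiber_le hs hq hE hc hbc z.1.ne_zero z.2.ne_zero
    have h2 : ((q - 1 : ℕ) : ℝ) = (q : ℝ) - 1 := by
      rw [Nat.cast_sub (by omega)]; simp
    rw [← h2]
    exact_mod_cast this
  have hsum : ∑ x : E, χ (Algebra.norm F x) * ψ (Algebra.norm F (f x))
      = ∑ z : Fˣ × Fˣ, (N z : ℂ) * (χ z.1 * ψ z.2) := by
    have h1 : ∀ z : Fˣ × Fˣ, (N z : ℂ) * (χ z.1 * ψ z.2) = ∑ x : E,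
        if Algebra.norm F x = z.1 ∧ Algebra.norm F (f x) = z.2 then
          χ (Algebra.norm F x) * ψ (Algebra.norm F (f x)) else 0 := by
      intro z
      rw [← Finset.sum_filter, Finset.sum_congr rfl (g := fun _ => χ z.1 * ψ z.2), Finset.sum_const,
        nsmul_eq_mul]
      intro x hx
      rw [Finset.mem_filter] at hx
      rw [hx.2.1, hx.2.2]
    simp_rw [h1]
    rw [Finset.sum_comm]
    refine Finset.sum_congr rfl fun x _ => ?_
    by_cases hx : Algebra.norm F x = 0
    · rw [hx, MulChar.map_zero, zero_mul]
      simp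
    by_cases hfx : Algebra.norm F (f x) = 0
    · rw [hfx, MulChar.map_zero, mul_zero]
      simp
    rw [Finset.sum_eq_single (⟨Units.mk0 _ hx, Units.mk0 _ hfx⟩ : Fˣ × Fˣ)]
    · simp
    · intro z _ hz
      rw [if_neg]
      rintro ⟨h2, h3⟩
      apply hz
      ext <;> simp [h2, h3]
    · simp
  have hzero : ∑ z : Fˣ × Fˣ, χ z.1 * ψ z.2 = 0 := by
    rw [Fintype.sum_prod_type]
    simp_rw [← Finset.mul_sum, ← Finset.sum_mul]
    have : ∑ u : Fˣ, χ u = 0 := by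
      have h := MulChar.sum_eq_zero_of_ne_one hχ
      rw [← Finset.add_sum_erase _ _ (Finset.mem_univ 0), MulChar.map_zero, zero_add] at h
      rw [← h]
      refine Finset.sum_bij (fun u _ => (u : F)) ?_ ?_ ?_ ?_
      · simp
      · intro a _ b _ h; exact Units.ext h
      · intro a ha
        exact ⟨Units.mk0 a (by simpa using ha), by simp⟩
      · simp
    rw [this, zero_mul]
  have hcount : (q : ℝ) ^ (2 * s) - 3 ≤ ∑ z, (N z : ℝ) := by
    have h1 : (Finset.univ : Finset E) ⊆ ({0} ∪ (X ^ 2 + C (algebraMap F E b) * X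
        + C (algebraMap F E c) : E[X]).roots.toFinset) ∪
        (Finset.univ : Finset (Fˣ × Fˣ)).biUnion (fun z => Finset.univ.filter fun x : E =>
          Algebra.norm F x = z.1 ∧ Algebra.norm F (f x) = z.2) := by
      intro x _
      by_cases hx : x = 0
      · simp [hx]
      have hmon : (X ^ 2 + C (algebraMap F E b) * X + C (algebraMap F E c) : E[X]).Monic := by
        monicity!
      by_cases hfx : f x = 0
      · refine Finset.mem_union_left _ (Finset.mem_union_right _ ?_)
        rw [Multiset.mem_toFinset, mem_roots hmon.ne_zero]
        simpa [f] using hfx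
      · refine Finset.mem_union_right _ (Finset.mem_biUnion.2
          ⟨⟨Units.mk0 _ (Algebra.norm_ne_zero_iff.2 hx),
            Units.mk0 _ (Algebra.norm_ne_zero_iff.2 hfx)⟩, Finset.mem_univ _, ?_⟩)
        rw [Finset.mem_filter]
        exact ⟨Finset.mem_univ _, rfl, rfl⟩
    have h2 := (Finset.card_le_card h1).trans (Finset.card_union_le _ _)
    have h3 : ({0} ∪ (X ^ 2 + C (algebraMap F E b) * X
        + C (algebraMap F E c) : E[X]).roots.toFinset).card ≤ 1 + 2 := by
      refine (Finset.card_union_le _ _).trans (Nat.add_le_add (by simp) ?_)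
      refine (Multiset.toFinset_card_le _).trans ((card_roots' _).trans ?_)
      compute_degree
    have h4 : (Finset.univ.biUnion (fun z : Fˣ × Fˣ => Finset.univ.filter fun x : E =>
          Algebra.norm F x = z.1 ∧ Algebra.norm F (f x) = z.2)).card ≤ ∑ z, N z :=
      Finset.card_biUnion_le
    rw [Finset.card_univ, hE] at h2
    have h5 : q ^ (2 * s) ≤ 3 + ∑ z, N z := by omega
    have h6 : (q : ℝ) ^ (2 * s) ≤ 3 + ∑ z, (N z : ℝ) := by exact_mod_cast h5
    linarith
  have hcardu : (Fintype.card (Fˣ × Fˣ) : ℝ) = ((q : ℝ) - 1) ^ 2 := by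
    rw [Fintype.card_prod, Fintype.card_units, Nat.cast_mul, Nat.cast_sub (by omega)]
    push_cast
    ring
  have hS : ∑ z : Fˣ × Fˣ, (N z : ℂ) * (χ z.1 * ψ z.2)
      = -∑ z : Fˣ × Fˣ, ((M - N z : ℝ) : ℂ) * (χ z.1 * ψ z.2) := by
    have : ∑ z : Fˣ × Fˣ, ((M - N z : ℝ) : ℂ) * (χ z.1 * ψ z.2)
        = (M : ℂ) * ∑ z : Fˣ × Fˣ, χ z.1 * ψ z.2 - ∑ z : Fˣ × Fˣ, (N z : ℂ) * (χ z.1 * ψ z.2) := by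
      rw [Finset.mul_sum, ← Finset.sum_sub_distrib]
      refine Finset.sum_congr rfl fun z _ => ?_
      push_cast
      ring
    rw [this, hzero]
    ring
  have hnorm : ∀ (φ : MulChar F ℂ) (u : Fˣ), ‖φ u‖ = 1 := fun φ u => by
    refine Complex.norm_eq_one_of_pow_eq_one (n := Fintype.card Fˣ) ?_ Fintype.card_ne_zero
    rw [← map_pow, ← Units.val_pow_eq_pow_val, pow_card_eq_one, Units.val_one, map_one]
  change ‖∑ x : E, χ (Algebra.norm F x) * ψ (Algebra.norm F (f x))‖ ≤ _
  rw [hsum, hS, norm_neg]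
  refine (norm_sum_le _ _).trans ?_
  have h7 : ∀ z : Fˣ × Fˣ, ‖((M - N z : ℝ) : ℂ) * (χ z.1 * ψ z.2)‖ = M - N z := fun z => by
    rw [norm_mul, norm_mul, hnorm, hnorm, Complex.norm_real, Real.norm_eq_abs,
      abs_of_nonneg (sub_nonneg.2 (hNM z))]
    ring
  simp_rw [h7]
  rw [Finset.sum_sub_distrib, Finset.sum_const, Finset.card_univ, nsmul_eq_mul, hcardu, hM,
    mul_div_cancel₀ _ (by positivity)]
  have h8 : (1 : ℝ) ≤ (q : ℝ) ^ s := one_le_pow₀ (by linarith)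
  have h9 : ((q : ℝ) - 1) ^ 2 * (q : ℝ) ^ s ≤ (q : ℝ) ^ 2 * (q : ℝ) ^ s := by
    gcongr
    linarith
  nlinarith

section
variable (F : Type*) [Field F] [Fintype F]

theorem finite_monic_natDegree_eq (n : ℕ) : {g : F[X] | g.Monic ∧ g.natDegree = n}.Finite := by
  have : Finite (degreeLT F n) := Finite.of_equiv _ (degreeLTEquiv F n).symm.toEquiv
  have : Finite {g : F[X] | g.Monic ∧ g.natDegree = n} :=
    Finite.of_equiv _ (monicEquivDegreeLT n).symm
  exact Set.toFinite _

/-- The finite set of monic polynomials of degree `n`. -/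
noncomputable def monics (n : ℕ) : Finset F[X] := (finite_monic_natDegree_eq F n).toFinset

/-- The finite set of monic irreducible polynomials whose degree divides `n`. -/
noncomputable def primesOfDegreeDvd (n : ℕ) : Finset F[X] := by
  classical
  exact (n.divisors.biUnion (monics F)).filter Irreducible

variable {F}

theorem mem_monics {n : ℕ} {g : F[X]} : g ∈ monics F n ↔ g.Monic ∧ g.natDegree = n := by
  simp [monics]

theorem mem_primesOfDegreeDvd {n : ℕ} (hn : n ≠ 0) {g : F[X]} :
    g ∈ primesOfDegreeDvd F n ↔ g.Monic ∧ Irreducible g ∧ g.natDegree ∣ n := by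
  simp [primesOfDegreeDvd, mem_monics, hn]
  tauto

theorem natDegree_eq_sum_primesOfDegreeDvd {n : ℕ} {g : F[X]} (hg : g ∈ monics F n) :
    n = ∑ j ∈ Finset.Icc 1 n, ∑ P ∈ primesOfDegreeDvd F j,
      if P ^ (j / P.natDegree) ∣ g then P.natDegree else 0 := by
  obtain ⟨hm, hd⟩ := mem_monics.1 hg
  have hg0 := hm.ne_zero
  let s := UniqueFactorizationMonoid.normalizedFactors g
  have hprod : s.prod = g := by
    rw [UniqueFactorizationMonoid.prod_normalizedFactors_eq hg0, hm.normalize_eq_self]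
  have hirr : ∀ P ∈ s, Irreducible P := fun P hP =>
    UniqueFactorizationMonoid.irreducible_of_normalized_factor P hP
  have hmon : ∀ P ∈ s, P.Monic := fun P hP => by
    have h := UniqueFactorizationMonoid.normalize_normalized_factor P hP
    rw [← h]
    exact Polynomial.monic_normalize (hirr P hP).ne_zero
  have hcount : ∀ P : F[X], P.Monic → Irreducible P → ∀ m, P ^ m ∣ g ↔ m ≤ s.count P := by
    intro P hPm hP m
    rw [pow_dvd_iff_le_emultiplicity,
      UniqueFactorizationMonoid.emultiplicity_eq_count_normalizedFactors hP hg0,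
      hPm.normalize_eq_self]
    exact Nat.cast_le
  have h1 : n = ∑ P ∈ s.toFinset, ∑ m ∈ Finset.Icc 1 (s.count P), P.natDegree := by
    have h2 : g.natDegree = (s.map natDegree).sum := by
      conv_lhs => rw [← hprod]
      exact natDegree_multiset_prod _ fun h => (hirr 0 h).ne_zero rfl
    rw [← hd, h2, Finset.sum_multiset_map_count]
    simp
  conv_lhs => rw [h1]
  simp_rw [← Finset.sum_filter]
  rw [Finset.sum_sigma', Finset.sum_sigma']
  refine Finset.sum_bij' (fun x _ => ⟨x.2 * x.1.natDegree, x.1⟩)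
    (fun y _ => ⟨y.2, y.1 / y.2.natDegree⟩) ?_ ?_ ?_ ?_ ?_
  · rintro ⟨P, m⟩ h
    simp only [Finset.mem_sigma, Multiset.mem_toFinset, Finset.mem_Icc, Finset.mem_filter] at h ⊢
    obtain ⟨hP, hm1, hm2⟩ := h
    have hPd := (hirr P hP).natDegree_pos
    have hdvd := (hcount P (hmon P hP) (hirr P hP) m).2 hm2
    rw [mem_primesOfDegreeDvd (by positivity), Nat.mul_div_cancel _ hPd]
    refine ⟨⟨Nat.mul_pos hm1 hPd, ?_⟩, ⟨hmon P hP, hirr P hP, dvd_mul_left _ _⟩, hdvd⟩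
    rw [← hd, ← natDegree_pow]
    exact natDegree_le_of_dvd hdvd hg0
  · rintro ⟨j, P⟩ h
    simp only [Finset.mem_sigma, Multiset.mem_toFinset, Finset.mem_Icc, Finset.mem_filter] at h ⊢
    obtain ⟨⟨hj1, hj2⟩, hP, hdvd⟩ := h
    obtain ⟨hPm, hPi, hPd⟩ := (mem_primesOfDegreeDvd (by omega)).1 hP
    have h3 := (hcount P hPm hPi _).1 hdvd
    have h4 : 1 ≤ j / P.natDegree :=
      Nat.div_pos (Nat.le_of_dvd hj1 hPd) hPi.natDegree_pos
    exact ⟨Multiset.count_pos.1 (by omega), h4, h3⟩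
  · rintro ⟨P, m⟩ h
    simp only [Finset.mem_sigma, Multiset.mem_toFinset] at h
    simp [Nat.mul_div_cancel _ (hirr P h.1).natDegree_pos]
  · rintro ⟨j, P⟩ h
    simp only [Finset.mem_sigma, Finset.mem_Icc, Finset.mem_filter] at h
    have := ((mem_primesOfDegreeDvd (by omega)).1 h.2.1).2.2
    simp [Nat.div_mul_cancel this]
  · intros; rfl

/-- The sum of a function over the monic polynomials of degree `n`. -/
noncomputable def monicSum (Λ : F[X] → ℂ) (n : ℕ) : ℂ := ∑ g ∈ monics F n, Λ g

/-- The `n`-th power sum attached to the Euler product of a multiplicative function. -/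
noncomputable def eulerPowerSum (Λ : F[X] → ℂ) (n : ℕ) : ℂ :=
  ∑ P ∈ primesOfDegreeDvd F n, P.natDegree * Λ P ^ (n / P.natDegree)

theorem natCast_mul_monicSum {Λ : F[X] → ℂ} (h1 : Λ 1 = 1)
    (hmul : ∀ g h : F[X], g.Monic → h.Monic → Λ (g * h) = Λ g * Λ h) (n : ℕ) :
    n * monicSum Λ n = ∑ j ∈ Finset.Icc 1 n, eulerPowerSum Λ j * monicSum Λ (n - j) := by
  classical
  have hpow : ∀ (P : F[X]) (m : ℕ), P.Monic → Λ (P ^ m) = Λ P ^ m := by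
    intro P m hP
    induction m with
    | zero => simpa using h1
    | succ m ih => rw [pow_succ, pow_succ, hmul _ _ (hP.pow m) hP, ih]
  have hL : n * monicSum Λ n = ∑ g ∈ monics F n, ∑ j ∈ Finset.Icc 1 n,
      ∑ P ∈ primesOfDegreeDvd F j, if P ^ (j / P.natDegree) ∣ g then P.natDegree * Λ g else 0 := by
    rw [monicSum, Finset.mul_sum]
    refine Finset.sum_congr rfl fun g hg => ?_
    conv_lhs => rw [natDegree_eq_sum_primesOfDegreeDvd hg]
    push_cast
    simp_rw [Finset.sum_mul, ite_mul, zero_mul]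
  rw [hL, Finset.sum_comm]
  refine Finset.sum_congr rfl fun j hj => ?_
  rw [Finset.sum_comm, eulerPowerSum, Finset.sum_mul]
  refine Finset.sum_congr rfl fun P hP => ?_
  rw [Finset.mem_Icc] at hj
  obtain ⟨hPm, hPi, hPd⟩ := (mem_primesOfDegreeDvd (by omega)).1 hP
  set m := j / P.natDegree with hm
  have hmj : m * P.natDegree = j := Nat.div_mul_cancel hPd
  rw [← Finset.sum_filter, ← Finset.mul_sum, mul_assoc]
  congr 1
  rw [monicSum, Finset.mul_sum]
  symm
  refine Finset.sum_bij (fun h _ => P ^ m * h) ?_ ?_ ?_ ?_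
  · intro h hh
    obtain ⟨ha, hb⟩ := mem_monics.1 hh
    rw [Finset.mem_filter, mem_monics, (hPm.pow m).natDegree_mul ha, hPm.natDegree_pow, hb, hmj]
    exact ⟨⟨(hPm.pow m).mul ha, by omega⟩, dvd_mul_right _ _⟩
  · intro a _ b _ hab
    exact mul_left_cancel₀ (hPm.pow m).ne_zero hab
  · intro g hg
    rw [Finset.mem_filter, mem_monics] at hg
    obtain ⟨⟨hgm, hgd⟩, h, rfl⟩ := hg
    have hh := (hPm.pow m).of_mul_monic_left hgm
    refine ⟨h, mem_monics.2 ⟨hh, ?_⟩, rfl⟩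
    rw [(hPm.pow m).natDegree_mul hh, hPm.natDegree_pow, hmj] at hgd
    omega
  · intro h hh
    rw [hmul _ _ (hPm.pow m) (mem_monics.1 hh).1, hpow _ _ hPm]

end

theorem algebraMap_resultant_eq_prod_aroots {F K : Type*} [Field F] [Field K] [Algebra F K]
    [IsAlgClosed K] {P : F[X]} (hP : P.Monic) (h : F[X]) :
    algebraMap F K (resultant P h) = ((P.aroots K).map fun r => aeval r h).prod := by
  rw [← resultant_map_map, ← natDegree_map (algebraMap F K),
    resultant_eq_prod_eval _ _ _ natDegree_map_le (IsAlgClosed.splits _),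
    (hP.map _).leadingCoeff, one_pow, one_mul]
  simp [aroots, aeval_def, eval_map]

open IntermediateField in
theorem norm_aeval_eq_resultant_pow {F E : Type*} [Field F] [Field E] [Algebra F E]
    [FiniteDimensional F E] [Algebra.IsSeparable F E] (x : E) (h : F[X]) :
    Algebra.norm F (aeval x h)
      = resultant (minpoly F x) h ^ (Module.finrank F E / (minpoly F x).natDegree) := by
  have hx : IsIntegral F x := Algebra.IsIntegral.isIntegral x
  have hfr : Module.finrank F F⟮x⟯ = (minpoly F x).natDegree := adjoin.finrank hx
  have hfr2 : Module.finrank F⟮x⟯ E = Module.finrank F E / (minpoly F x).natDegree := by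
    rw [← hfr, ← Module.finrank_mul_finrank F F⟮x⟯ E, Nat.mul_div_cancel_left _ Module.finrank_pos]
  have h1 : aeval x h = algebraMap F⟮x⟯ E (aeval (AdjoinSimple.gen F x) h) := by
    rw [← aeval_algebraMap_apply, AdjoinSimple.algebraMap_gen]
  rw [h1, ← Algebra.norm_norm (S := F⟮x⟯), Algebra.norm_algebraMap, map_pow, hfr2]
  congr 1
  let K := AlgebraicClosure F
  apply (algebraMap F K).injective
  have : Algebra.IsSeparable F F⟮x⟯ := Algebra.isSeparable_tower_bot_of_isSeparable F F⟮x⟯ E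
  classical
  rw [Algebra.norm_eq_prod_embeddings, algebraMap_resultant_eq_prod_aroots (minpoly.monic hx)]
  have hnodup : ((minpoly F x).aroots K).Nodup :=
    nodup_roots (Polynomial.Separable.map (Algebra.IsSeparable.isSeparable F x))
  have h2 : ((minpoly F x).aroots K).map (fun r => aeval r h)
      = (((minpoly F x).aroots K).toFinset.val.map fun r => aeval r h) := by
    rw [Multiset.toFinset_val, hnodup.dedup]
  rw [h2]
  change _ = ∏ r ∈ ((minpoly F x).aroots K).toFinset, aeval r h
  rw [← Finset.prod_coe_sort ((minpoly F x).aroots K).toFinset]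
  refine Fintype.prod_equiv ((algHomAdjoinIntegralEquiv F hx).trans
    (Equiv.subtypeEquivRight fun r => (Multiset.mem_toFinset).symm)) _ _ fun σ => ?_
  have h3 : (((algHomAdjoinIntegralEquiv F hx) σ : { r // r ∈ (minpoly F x).aroots K }) : K)
      = σ (AdjoinSimple.gen F x) := by
    conv_rhs => rw [← (algHomAdjoinIntegralEquiv F hx).symm_apply_apply σ]
    rw [algHomAdjoinIntegralEquiv_symm_apply_gen]
  simp only [Equiv.trans_apply, Equiv.subtypeEquivRight_apply_coe, h3]
  exact (aeval_algHom_apply σ _ h).symm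

theorem sum_minpoly_eq_sum_primesOfDegreeDvd {F E : Type*} [Field F] [Fintype F] [Field E]
    [Fintype E] [Algebra F E] (G : F[X] → ℂ) :
    ∑ x : E, G (minpoly F x)
      = ∑ P ∈ primesOfDegreeDvd F (Module.finrank F E), P.natDegree * G P := by
  classical
  have hx_int : ∀ x : E, IsIntegral F x := fun x => Algebra.IsIntegral.isIntegral x
  have hr : Module.finrank F E ≠ 0 := Module.finrank_pos.ne'
  rw [← Finset.sum_fiberwise_of_maps_to (s := Finset.univ)
    (t := primesOfDegreeDvd F (Module.finrank F E)) (g := fun x : E => minpoly F x)]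
  · refine Finset.sum_congr rfl fun P hP => ?_
    obtain ⟨hPm, hPi, hPd⟩ := (mem_primesOfDegreeDvd hr).1 hP
    rw [Finset.sum_congr rfl (g := fun _ => G P), Finset.sum_const, nsmul_eq_mul]
    · congr 2
      have hset : (Finset.univ.filter fun x : E => minpoly F x = P) = (P.aroots E).toFinset := by
        ext x
        rw [Finset.mem_filter, Multiset.mem_toFinset, mem_aroots]
        constructor
        · rintro ⟨-, rfl⟩
          exact ⟨hPm.ne_zero, minpoly.aeval _ _⟩
        · rintro ⟨-, hx⟩
          exact ⟨Finset.mem_univ _, (minpoly.eq_of_irreducible_of_monic hPi hx hPm).symm⟩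
      have hdvd : P.map (algebraMap F E) ∣ X ^ Fintype.card E - X := by
        have h := Polynomial.map_dvd (algebraMap F E)
          (hPi.natDegree_dvd_iff_dvd_X_pow_card_pow_sub_X.1 hPd)
        rw [Nat.card_eq_fintype_card, ← Module.card_eq_pow_finrank (K := F) (V := E)] at h
        simpa using h
      have hsplit : (P.map (algebraMap F E)).Splits := by
        refine Splits.of_dvd ?_ (FiniteField.X_pow_card_sub_X_ne_zero E Fintype.one_lt_card) hdvd
        rw [splits_iff_card_roots, FiniteField.roots_X_pow_card_sub_X,
          FiniteField.X_pow_card_sub_X_natDegree_eq E Fintype.one_lt_card]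
        rfl
      have hnd : (P.aroots E).Nodup := by
        refine nodup_roots (Separable.map ?_)
        exact PerfectField.separable_of_irreducible hPi
      rw [hset, Multiset.toFinset_card_of_nodup hnd, aroots, ← hsplit.natDegree_eq_card_roots,
        natDegree_map]
    · intro x hx
      rw [(Finset.mem_filter.1 hx).2]
  · intro x _
    exact (mem_primesOfDegreeDvd hr).2
      ⟨minpoly.monic (hx_int x), minpoly.irreducible (hx_int x), minpoly.degree_dvd (hx_int x)⟩

/-- The completely multiplicative function `g ↦ χ(Res(g, X)) ψ(Res(g, f))`. -/
noncomputable def resultantChar {F : Type*} [Field F] (χ ψ : MulChar F ℂ) (f g : F[X]) : ℂ :=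
  χ (resultant g X) * ψ (resultant g f)

theorem sum_mulChar_norm_eq_eulerPowerSum {F : Type*} (E : Type*) [Field F] [Fintype F] [Field E]
    [Fintype E] [Algebra F E] (χ ψ : MulChar F ℂ) (f : F[X]) :
    ∑ x : E, χ (Algebra.norm F x) * ψ (Algebra.norm F (aeval x f))
      = eulerPowerSum (resultantChar χ ψ f) (Module.finrank F E) := by
  rw [eulerPowerSum, ← sum_minpoly_eq_sum_primesOfDegreeDvd (E := E)
    (fun P => resultantChar χ ψ f P ^ (Module.finrank F E / P.natDegree))]
  refine Finset.sum_congr rfl fun x _ => ?_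
  have h := norm_aeval_eq_resultant_pow (F := F) x X
  rw [aeval_X] at h
  rw [h, norm_aeval_eq_resultant_pow, map_pow, map_pow, resultantChar, mul_pow]

theorem resultantChar_one {F : Type*} [Field F] (χ ψ : MulChar F ℂ) (f : F[X]) :
    resultantChar χ ψ f 1 = 1 := by
  simp [resultantChar]

theorem resultantChar_mul {F : Type*} [Field F] (χ ψ : MulChar F ℂ) (f : F[X]) {g h : F[X]}
    (hg : g.Monic) (hh : h.Monic) :
    resultantChar χ ψ f (g * h) = resultantChar χ ψ f g * resultantChar χ ψ f h := by
  simp only [resultantChar]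
  rw [hg.natDegree_mul hh, resultant_mul_left _ _ _ _ le_rfl, resultant_mul_left _ _ _ _ le_rfl,
    map_mul, map_mul]
  ring

theorem monicSum_resultantChar_eq_zero {F : Type*} [Field F] [Fintype F] {χ : MulChar F ℂ}
    (hχ : χ ≠ 1) (ψ : MulChar F ℂ) {f : F[X]} (hf : f.coeff 0 ≠ 0) {n : ℕ}
    (hn : f.natDegree < n) : monicSum (resultantChar χ ψ f) n = 0 := by
  classical
  have hdeg : ∀ (g : F[X]) (u : F), g ∈ monics F n → g + C u * f ∈ monics F n := by
    intro g u hg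
    obtain ⟨hm, hd⟩ := mem_monics.1 hg
    have h1 : (C u * f).natDegree < g.natDegree :=
      (natDegree_C_mul_le u f).trans_lt (hn.trans_eq hd.symm)
    have h2 := degree_lt_degree h1
    exact mem_monics.2 ⟨hm.add_of_left h2, (natDegree_add_eq_left_of_natDegree_lt h1).trans hd⟩
  have hshift : ∀ u : F, monicSum (resultantChar χ ψ f) n
      = ∑ g ∈ monics F n, resultantChar χ ψ f (g + C u * f) := by
    intro u
    refine Finset.sum_bij' (fun g _ => g + C (-u) * f) (fun g _ => g + C u * f)
      (fun g hg => hdeg g _ hg) (fun g hg => hdeg g _ hg) ?_ ?_ ?_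
    · intro g _; simp
    · intro g _; simp
    · intro g _; simp
  have hval : ∀ g ∈ monics F n, ∑ u : F, resultantChar χ ψ f (g + C u * f) = 0 := by
    intro g hg
    have h1 : ∀ u : F, resultantChar χ ψ f (g + C u * f)
        = χ ((-1) ^ n) * ψ (resultant g f n f.natDegree) * χ (g.coeff 0 + u * f.coeff 0) := by
      intro u
      have hd := (mem_monics.1 (hdeg g u hg)).2
      rw [resultantChar, hd, mul_comm (C u) f, resultant_add_mul_left _ _ _ _ _ (by simpa using hn.le) le_rfl]
      have h2 := resultant_X_sub_C_right (g + f * C u) n 0 (by rw [mul_comm f, hd])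
      rw [C_0, sub_zero] at h2
      rw [natDegree_X, h2, map_mul, eval_add, eval_mul, eval_C, ← coeff_zero_eq_eval_zero,
        ← coeff_zero_eq_eval_zero, mul_comm u]
      ring
    simp_rw [h1]
    rw [← Finset.mul_sum]
    have h3 : ∑ u : F, χ (g.coeff 0 + u * f.coeff 0) = ∑ v : F, χ v :=
      Fintype.sum_equiv ((Equiv.mulRight₀ _ hf).trans (Equiv.addLeft (g.coeff 0))) _ _
        fun u => by simp
    rw [h3, MulChar.sum_eq_zero_of_ne_one hχ, mul_zero]
  have hq : (Fintype.card F : ℂ) * monicSum (resultantChar χ ψ f) n = 0 := by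
    rw [← nsmul_eq_mul, ← Finset.card_univ, ← Finset.sum_const,
      Finset.sum_congr rfl fun u _ => hshift u, Finset.sum_comm]
    exact Finset.sum_eq_zero hval
  exact (mul_eq_zero.1 hq).resolve_left (by simp)

theorem le_one_of_pow_le {y C : ℝ} (h : ∀ s : ℕ, 2 ≤ s → y ^ s ≤ C) : y ≤ 1 := by
  by_contra! hy
  obtain ⟨n, hn⟩ := pow_unbounded_of_one_lt C hy
  have h1 : y ^ n ≤ y ^ (n + 2) := pow_le_pow_right₀ hy.le (by omega)
  linarith [h (n + 2) (by omega)]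

theorem norm_le_one_of_norm_pow_add_pow_le {α β : ℂ} {C : ℝ}
    (h : ∀ s : ℕ, 2 ≤ s → ‖α ^ s + β ^ s‖ ≤ C) : ‖α‖ ≤ 1 := by
  have hprod : ‖α * β‖ ≤ 1 := by
    refine le_one_of_pow_le (C := (C ^ 2 + C) / 2) fun s hs => ?_
    have h1 : (α * β) ^ s = ((α ^ s + β ^ s) ^ 2 - (α ^ (2 * s) + β ^ (2 * s))) / 2 := by ring
    rw [← norm_pow, h1, norm_div, Complex.norm_ofNat]
    have h2 := norm_sub_le ((α ^ s + β ^ s) ^ 2) (α ^ (2 * s) + β ^ (2 * s))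
    rw [norm_pow] at h2
    have h3 : ‖α ^ s + β ^ s‖ ^ 2 ≤ C ^ 2 := by gcongr; exact h s hs
    linarith [h (2 * s) (by omega)]
  by_contra! hα
  rw [norm_mul] at hprod
  have hβ : ‖β‖ ≤ 1 := by nlinarith [norm_nonneg β]
  refine absurd (le_one_of_pow_le (C := C + 1) fun s hs => ?_) (not_le.2 hα)
  have h1 : α ^ s = (α ^ s + β ^ s) - β ^ s := by ring
  rw [← norm_pow, h1]
  refine (norm_sub_le _ _).trans (add_le_add (h s hs) ?_)
  rw [norm_pow]
  exact pow_le_one₀ (norm_nonneg _) hβ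

theorem exists_eulerPowerSum_eq {F : Type*} [Field F] [Fintype F] {Λ : F[X] → ℂ} (h1 : Λ 1 = 1)
    (hmul : ∀ g h : F[X], g.Monic → h.Monic → Λ (g * h) = Λ g * Λ h)
    (hzero : ∀ n, 3 ≤ n → monicSum Λ n = 0) :
    ∃ ω₁ ω₂ : ℂ, ∀ n, 1 ≤ n → eulerPowerSum Λ n = -(ω₁ ^ n + ω₂ ^ n) := by
  have hc0 : monicSum Λ 0 = 1 := by
    have : monics F 0 = {1} := by
      ext g
      rw [mem_monics, Finset.mem_singleton]
      constructor
      · rintro ⟨hm, hd⟩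
        exact hm.natDegree_eq_zero.1 hd
      · rintro rfl
        simp
    rw [monicSum, this, Finset.sum_singleton, h1]
  have hN := natCast_mul_monicSum h1 hmul
  have hS1 := hN 1
  have hS2 := hN 2
  have hS : ∀ n, eulerPowerSum Λ (n + 3) = -(eulerPowerSum Λ (n + 2) * monicSum Λ 1
      + eulerPowerSum Λ (n + 1) * monicSum Λ 2) := by
    intro n
    have h := hN (n + 3)
    rw [hzero _ (by omega), mul_zero, Finset.sum_Icc_succ_top (by omega),
      Finset.sum_Icc_succ_top (by omega), Finset.sum_Icc_succ_top (by omega),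
      Finset.sum_eq_zero, Nat.sub_self, hc0, show n + 2 + 1 - (n + 1 + 1) = 1 by omega,
      show n + 2 + 1 - (n + 1) = 2 by omega] at h
    · linear_combination -h
    · intro j hj
      rw [Finset.mem_Icc] at hj
      rw [hzero _ (by omega), mul_zero]
  simp [Finset.sum_Icc_succ_top, hc0] at hS1 hS2
  obtain ⟨d, hd⟩ := IsAlgClosed.exists_pow_nat_eq (monicSum Λ 1 ^ 2 - 4 * monicSum Λ 2)
    (n := 2) (by omega)
  refine ⟨(-monicSum Λ 1 + d) / 2, (-monicSum Λ 1 - d) / 2, fun n hn => ?_⟩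
  set ω₁ := (-monicSum Λ 1 + d) / 2 with hω₁
  set ω₂ := (-monicSum Λ 1 - d) / 2 with hω₂
  have hadd : monicSum Λ 1 = -(ω₁ + ω₂) := by rw [hω₁, hω₂]; ring
  have hm : monicSum Λ 2 = ω₁ * ω₂ := by rw [hω₁, hω₂]; linear_combination (1 / 4 : ℂ) * hd
  rw [hadd] at hS1
  rw [hm, hadd, ← hS1] at hS2
  have hS2' : eulerPowerSum Λ 2 = -(ω₁ ^ 2 + ω₂ ^ 2) := by linear_combination -hS2
  rw [hm, hadd] at hS
  have key : ∀ n, eulerPowerSum Λ (n + 1) = -(ω₁ ^ (n + 1) + ω₂ ^ (n + 1)) ∧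
      eulerPowerSum Λ (n + 2) = -(ω₁ ^ (n + 2) + ω₂ ^ (n + 2)) := by
    intro n
    induction n with
    | zero => exact ⟨by simpa using hS1.symm, hS2'⟩
    | succ n ih =>
      refine ⟨ih.2, ?_⟩
      rw [show n + 1 + 2 = n + 3 by omega, hS, ih.1, ih.2]
      ring
  obtain ⟨m, rfl⟩ : ∃ m, n = m + 1 := ⟨n - 1, by omega⟩
  exact (key m).1

theorem norm_sum_mulChar_monic_quadratic_le {F : Type*} [Field F] [Fintype F]
    (hq : 3 ≤ Fintype.card F) {b c : F} (hc : c ≠ 0) (hbc : b ^ 2 - 4 * c ≠ 0)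
    {χ : MulChar F ℂ} (hχ : χ ≠ 1) (ψ : MulChar F ℂ) :
    ‖∑ x : F, χ x * ψ (x ^ 2 + b * x + c)‖ ≤ 2 * √(Fintype.card F) := by
  set q : ℝ := (Fintype.card F : ℝ) with hqdef
  have hq0 : 0 < q := by rw [hqdef]; exact_mod_cast Fintype.card_pos
  let f : F[X] := X ^ 2 + C b * X + C c
  have hfdeg : f.natDegree ≤ 2 := by simp only [f]; compute_degree
  have hf0 : f.coeff 0 ≠ 0 := by simpa [f] using hc
  obtain ⟨ω₁, ω₂, hω⟩ := exists_eulerPowerSum_eq (Λ := resultantChar χ ψ f)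
    (resultantChar_one χ ψ f) (fun g h => resultantChar_mul χ ψ f)
    (fun n hn => monicSum_resultantChar_eq_zero hχ ψ hf0 (by omega))
  have hS1 : ∑ x : F, χ x * ψ (x ^ 2 + b * x + c) = -(ω₁ + ω₂) := by
    have h := sum_mulChar_norm_eq_eulerPowerSum F χ ψ f
    rw [Module.finrank_self, hω 1 le_rfl, pow_one, pow_one] at h
    rw [← h]
    refine Finset.sum_congr rfl fun x _ => ?_
    simp [f, Algebra.norm_self]
  have hS : ∀ s : ℕ, 2 ≤ s → ‖ω₁ ^ (2 * s) + ω₂ ^ (2 * s)‖ ≤ (7 * q ^ 2 + 3) * q ^ s := by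
    intro s hs
    let p := ringChar F
    have : Fact p.Prime := ⟨CharP.char_is_prime F p⟩
    have : NeZero (2 * s) := ⟨by omega⟩
    let E := FiniteField.Extension F p (2 * s)
    have : Fintype E := Fintype.ofFinite E
    have hE : Fintype.card E = Fintype.card F ^ (2 * s) := by
      rw [← Nat.card_eq_fintype_card, ← Nat.card_eq_fintype_card]
      exact FiniteField.natCard_extension F p (2 * s)
    have h := norm_sum_mulChar_norm_le hs hq hE hc hbc hχ ψ
    have h2 := sum_mulChar_norm_eq_eulerPowerSum E χ ψ f
    have haeval : ∀ x : E, aeval x f = x ^ 2 + algebraMap F E b * x + algebraMap F E c := by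
      intro x
      simp [f]
    simp_rw [haeval] at h2
    rw [h2, FiniteField.finrank_extension, hω _ (by omega), norm_neg] at h
    exact h
  have hdiv : ∀ u v : ℂ, (∀ s : ℕ, 2 ≤ s → ‖u ^ (2 * s) + v ^ (2 * s)‖ ≤ (7 * q ^ 2 + 3) * q ^ s) →
      ‖u‖ ≤ √q := by
    intro u v huv
    have h := norm_le_one_of_norm_pow_add_pow_le (α := u ^ 2 / q) (β := v ^ 2 / q)
      (C := 7 * q ^ 2 + 3) fun s hs => by
        have h3 : (u ^ 2 / q) ^ s + (v ^ 2 / q) ^ s = (u ^ (2 * s) + v ^ (2 * s)) / (q : ℂ) ^ s := by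
          rw [div_pow, div_pow, ← pow_mul, ← pow_mul, add_div]
        rw [h3, norm_div, norm_pow, Complex.norm_real, Real.norm_of_nonneg hq0.le,
          div_le_iff₀ (by positivity)]
        exact huv s hs
    rw [norm_div, norm_pow, Complex.norm_real, Real.norm_of_nonneg hq0.le, div_le_one hq0] at h
    exact Real.le_sqrt_of_sq_le h
  rw [hS1, norm_neg]
  refine (norm_add_le _ _).trans ?_
  have := hdiv ω₁ ω₂ hS
  have := hdiv ω₂ ω₁ fun s hs => by rw [add_comm]; exact hS s hs
  linarith

end PolynomialPart

theorem MulChar.norm_apply_eq_one {F : Type*} [Field F] [Fintype F] (χ : MulChar F ℂ) {u : F}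
    (hu : u ≠ 0) : ‖χ u‖ = 1 := by
  refine Complex.norm_eq_one_of_pow_eq_one (n := Fintype.card F - 1) ?_
    (Nat.sub_ne_zero_of_lt Fintype.one_lt_card)
  rw [← map_pow, FiniteField.pow_card_sub_one_eq_one u hu, map_one]

theorem norm_jacobiSum_le {F : Type*} [Field F] [Fintype F] {χ ψ : MulChar F ℂ}
    (h : ¬(χ = 1 ∧ ψ = 1)) : ‖jacobiSum χ ψ‖ ≤ √(Fintype.card F) := by
  have h1 : 1 ≤ √(Fintype.card F : ℝ) :=
    Real.one_le_sqrt.2 (by exact_mod_cast Fintype.card_pos)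
  by_cases hχ : χ = 1
  · rw [hχ, jacobiSum_one_nontrivial fun hψ => h ⟨hχ, hψ⟩, norm_neg, norm_one]
    exact h1
  by_cases hψ : ψ = 1
  · rw [hψ, jacobiSum_comm, jacobiSum_one_nontrivial hχ, norm_neg, norm_one]
    exact h1
  by_cases hχψ : χ * ψ = 1
  · rw [eq_inv_of_mul_eq_one_right hχψ, jacobiSum_nontrivial_inv hχ, norm_neg,
      χ.norm_apply_eq_one (neg_ne_zero.2 one_ne_zero)]
    exact h1
  have hchar : ringChar ℂ ≠ ringChar F := by
    rw [ringChar.eq_zero]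
    exact (CharP.ringChar_ne_zero_of_finite F).symm
  have hJ := jacobiSum_mul_jacobiSum_inv hchar hχ hψ hχψ
  have hstar : jacobiSum χ⁻¹ ψ⁻¹ = star (jacobiSum χ ψ) := by
    simp only [jacobiSum, star_sum, star_mul', MulChar.star_apply']
  rw [hstar, ← starRingEnd_apply, Complex.mul_conj, Complex.normSq_eq_norm_sq] at hJ
  have hJ' : ‖jacobiSum χ ψ‖ ^ 2 = (Fintype.card F : ℝ) := by exact_mod_cast hJ
  exact Real.le_sqrt_of_sq_le hJ'.le

theorem norm_sum_mulChar_quadratic_le {F : Type*} [Field F] [Fintype F]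
    (hq : 3 ≤ Fintype.card F) {a b c : F} (ha : a ≠ 0) (hbc : b ^ 2 - 4 * a * c ≠ 0)
    {χ : MulChar F ℂ} (hχ : χ ≠ 1) (ψ : MulChar F ℂ) :
    ‖∑ x : F, χ x * ψ (a * x ^ 2 + b * x + c)‖ ≤ 2 * √(Fintype.card F) := by
  by_cases hc : c = 0
  · subst hc
    have hb : b ≠ 0 := by
      rintro rfl
      simp at hbc
    have hab : -(b / a) ≠ 0 := neg_ne_zero.2 (div_ne_zero hb ha)
    have h1 : ∑ x : F, χ x * ψ (a * x ^ 2 + b * x + 0)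
        = (χ * ψ) (-(b / a)) * ψ b * jacobiSum (χ * ψ) ψ := by
      rw [jacobiSum, Finset.mul_sum]
      refine (Fintype.sum_equiv (Equiv.mulLeft₀ _ hab) _ _ fun y => ?_).symm
      have h2 : a * (-(b / a) * y) ^ 2 + b * (-(b / a) * y) + 0
          = (-(b / a) * y) * (b * (1 - y)) := by
        field_simp
        ring
      rw [show Equiv.mulLeft₀ _ hab y = -(b / a) * y from rfl, h2, map_mul ψ, map_mul ψ b]
      simp only [MulChar.mul_apply, map_mul]
      ring
    rw [h1, norm_mul, norm_mul, MulChar.norm_apply_eq_one _ hab, MulChar.norm_apply_eq_one _ hb,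
      one_mul, one_mul]
    refine (norm_jacobiSum_le ?_).trans (by linarith [Real.sqrt_nonneg (Fintype.card F : ℝ)])
    rintro ⟨h3, rfl⟩
    exact hχ (by simpa using h3)
  · have h1 : ∑ x : F, χ x * ψ (a * x ^ 2 + b * x + c)
        = ψ a * ∑ x : F, χ x * ψ (x ^ 2 + (b / a) * x + c / a) := by
      rw [Finset.mul_sum]
      refine Finset.sum_congr rfl fun x _ => ?_
      have : a * x ^ 2 + b * x + c = a * (x ^ 2 + (b / a) * x + c / a) := by field_simp
      rw [this, map_mul]
      ring
    rw [h1, norm_mul, ψ.norm_apply_eq_one ha, one_mul]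
    refine norm_sum_mulChar_monic_quadratic_le hq (div_ne_zero hc ha) ?_ hχ ψ
    have : (b / a) ^ 2 - 4 * (c / a) = (b ^ 2 - 4 * a * c) / a ^ 2 := by field_simp
    rw [this]
    exact div_ne_zero hbc (pow_ne_zero _ ha)

theorem MulChar.sum_pow_apply_eq {F : Type*} [Field F] [Fintype F] (θ : MulChar F ℂ) (x : F) :
    ∑ j ∈ Finset.range (orderOf θ), (θ ^ j) x
      = if ∃ y : F, y ≠ 0 ∧ y ^ orderOf θ = x then (orderOf θ : ℂ) else 0 := by
  have hθ0 : orderOf θ ≠ 0 := (orderOf_pos θ).ne'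
  have hpow : ∀ (j : ℕ) {u : F}, u ≠ 0 → (θ ^ j) u = θ u ^ j := by
    intro j u hu
    simpa using MulChar.pow_apply_coe θ j (Units.mk0 u hu)
  split_ifs with h
  · obtain ⟨y, hy0, rfl⟩ := h
    rw [Finset.sum_congr rfl (g := fun _ => (1 : ℂ))]
    · simp
    · intro j _
      rw [hpow _ (pow_ne_zero _ hy0), map_pow, ← hpow _ hy0, pow_orderOf_eq_one,
        MulChar.one_apply hy0.isUnit, one_pow]
  · by_cases hx : x = 0
    · exact Finset.sum_eq_zero fun j _ => by rw [hx, MulChar.map_zero]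
    rw [Finset.sum_congr rfl fun j _ => hpow j hx]
    have hne : θ x ≠ 1 := by
      intro h1
      apply h
      obtain ⟨g, hg⟩ := IsCyclic.exists_generator (α := Fˣ)
      obtain ⟨n, hn⟩ := (Submonoid.mem_powers_iff _ _).1
        ((mem_powers_iff_mem_zpowers (x := g)).2 (hg (Units.mk0 x hx)))
      have hx' : x = (g : F) ^ n := by
        rw [← Units.val_pow_eq_pow_val, hn, Units.val_mk0]
      have h2 : θ ^ n = 1 := by
        rw [MulChar.eq_iff hg, MulChar.pow_apply_coe, ← map_pow, ← hx', h1,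
          MulChar.one_apply_coe]
      obtain ⟨m, rfl⟩ := orderOf_dvd_of_pow_eq_one h2
      exact ⟨(g : F) ^ m, pow_ne_zero _ g.ne_zero, by rw [hx', ← pow_mul, mul_comm]⟩
    have h3 : θ x ^ orderOf θ = 1 := by
      rw [← hpow _ hx, pow_orderOf_eq_one, MulChar.one_apply (Ne.isUnit hx)]
    rw [geom_sum_eq hne, h3, sub_self, zero_div]

theorem exists_mulChar_orderOf_eq {F : Type*} [Field F] [Fintype F] {n : ℕ}
    (h : n ∣ Fintype.card F - 1) : ∃ θ : MulChar F ℂ, orderOf θ = n := by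
  have hn : n ≠ 0 := by
    rintro rfl
    exact Nat.sub_ne_zero_of_lt Fintype.one_lt_card (zero_dvd_iff.1 h)
  exact MulChar.exists_mulChar_orderOf F h (Complex.isPrimitiveRoot_exp n hn)

theorem isTFree_iff {F : Type*} [Field F] {t : ℕ} (ht : t ≠ 0) {x : F} :
    IsTFree t x ↔ x ≠ 0 ∧ ∀ l ∈ t.primeFactors, ¬∃ y : F, y ≠ 0 ∧ y ^ l = x := by
  refine and_congr_right fun _ => ⟨fun h l hl => ?_, fun h d hd hdt => ?_⟩
  · rintro ⟨y, -, hy⟩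
    have hl' := Nat.prime_of_mem_primeFactors hl
    exact hl'.ne_one (h l hl'.pos (Nat.dvd_of_mem_primeFactors hl) ⟨y, hy⟩)
  · rintro ⟨y, hy⟩
    by_contra hd1
    obtain ⟨l, hl, m, rfl⟩ := Nat.exists_prime_and_dvd hd1
    refine h l (Nat.mem_primeFactors.2 ⟨hl, (dvd_mul_right _ _).trans hdt, ht⟩)
      ⟨y ^ m, pow_ne_zero _ ?_, by rw [← pow_mul, mul_comm, hy]⟩
    rintro rfl
    rw [zero_pow hd.ne'] at hy
    exact absurd hy.symm ‹_›

/-- The sum of `χ` over the `x` that are `l`-th powers for no `l ∈ D` and satisfy `p`. -/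
noncomputable def sievedSum {F : Type*} [Field F] [Fintype F] (p : F → Prop) (D : Finset ℕ)
    (χ : MulChar F ℂ) : ℂ :=
  ∑ x with p x ∧ ∀ l ∈ D, ¬∃ y : F, y ≠ 0 ∧ y ^ l = x, χ x

theorem sievedSum_insert {F : Type*} [Field F] [Fintype F] (p : F → Prop) (D : Finset ℕ)
    (χ θ : MulChar F ℂ) :
    sievedSum p (insert (orderOf θ) D) χ = (1 - 1 / (orderOf θ : ℂ)) * sievedSum p D χ
      - 1 / (orderOf θ : ℂ) * ∑ j ∈ Finset.Ico 1 (orderOf θ), sievedSum p D (χ * θ ^ j) := by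
  set n := orderOf θ with hn
  have hn0 : 0 < n := orderOf_pos θ
  have hnC : (n : ℂ) ≠ 0 := by exact_mod_cast hn0.ne'
  have h1 : ∑ j ∈ Finset.range n, sievedSum p D (χ * θ ^ j)
      = sievedSum p D χ + ∑ j ∈ Finset.Ico 1 n, sievedSum p D (χ * θ ^ j) := by
    rw [Finset.range_eq_Ico, Finset.sum_eq_sum_Ico_succ_bot hn0, pow_zero, mul_one]
  have h2 : ∑ j ∈ Finset.range n, sievedSum p D (χ * θ ^ j)
      = n * (sievedSum p D χ - sievedSum p (insert n D) χ) := by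
    have h3 : sievedSum p (insert n D) χ
        = ∑ x with p x ∧ ∀ l ∈ D, ¬∃ y : F, y ≠ 0 ∧ y ^ l = x,
          if ∃ y : F, y ≠ 0 ∧ y ^ n = x then 0 else χ x := by
      rw [sievedSum, Finset.sum_filter, Finset.sum_filter]
      refine Finset.sum_congr rfl fun x _ => ?_
      simp only [Finset.forall_mem_insert]
      by_cases h : ∃ y : F, y ≠ 0 ∧ y ^ n = x <;> simp only [h] <;> simp
    rw [h3, sievedSum, ← Finset.sum_sub_distrib, Finset.mul_sum]
    simp only [sievedSum]
    rw [Finset.sum_comm]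
    refine Finset.sum_congr rfl fun x _ => ?_
    simp only [MulChar.mul_apply]
    rw [← Finset.mul_sum, hn, MulChar.sum_pow_apply_eq]
    split_ifs <;> ring
  rw [h2] at h1
  field_simp
  linear_combination -h1

theorem norm_sievedSum_empty_le {F : Type*} [Field F] [Fintype F] (hq : 3 ≤ Fintype.card F)
    {a b c : F} (ha : a ≠ 0) (hbc : b ^ 2 - 4 * a * c ≠ 0) {k : ℕ}
    (hk : k ∣ Fintype.card F - 1) {χ : MulChar F ℂ} (hχ : χ ≠ 1) :
    ‖sievedSum (fun x : F => ∃ y : F, y ≠ 0 ∧ y ^ k = a * x ^ 2 + b * x + c) ∅ χ‖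
      ≤ 2 * √(Fintype.card F) := by
  obtain ⟨θ, rfl⟩ := exists_mulChar_orderOf_eq hk
  set k := orderOf θ with hk'
  have hk0 : 0 < k := orderOf_pos θ
  have hkC : (k : ℂ) ≠ 0 := by exact_mod_cast hk0.ne'
  have h1 : (k : ℂ) * sievedSum (fun x : F => ∃ y : F, y ≠ 0 ∧ y ^ k = a * x ^ 2 + b * x + c) ∅ χ
      = ∑ j ∈ Finset.range k, ∑ x : F, χ x * (θ ^ j) (a * x ^ 2 + b * x + c) := by
    rw [Finset.sum_comm, sievedSum, Finset.mul_sum, Finset.sum_filter]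
    refine Finset.sum_congr rfl fun x _ => ?_
    rw [← Finset.mul_sum, hk', MulChar.sum_pow_apply_eq]
    simp only [Finset.notMem_empty, false_imp_iff, implies_true, and_true]
    split_ifs <;> ring
  have h2 : (k : ℝ) * ‖sievedSum (fun x : F => ∃ y : F, y ≠ 0 ∧ y ^ k = a * x ^ 2 + b * x + c) ∅ χ‖
      ≤ k * (2 * √(Fintype.card F)) := by
    rw [← Complex.norm_natCast, ← norm_mul, h1, Complex.norm_natCast]
    refine (norm_sum_le_of_le _ fun j _ =>
      norm_sum_mulChar_quadratic_le hq ha hbc hχ (θ ^ j)).trans ?_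
    simp
  exact le_of_mul_le_mul_left h2 (by exact_mod_cast hk0)

theorem norm_sievedSum_le {F : Type*} [Field F] [Fintype F] {p : F → Prop} {M : ℝ}
    (hM : ∀ χ : MulChar F ℂ, χ ≠ 1 → ‖sievedSum p ∅ χ‖ ≤ M) {D : Finset ℕ}
    (hD : ∀ l ∈ D, l ∣ Fintype.card F - 1) {χ : MulChar F ℂ} (hχ : χ ^ (∏ l ∈ D, l) ≠ 1) :
    ‖sievedSum p D χ‖ ≤ M * ∏ l ∈ D, (2 * (1 - 1 / (l : ℝ))) := by
  induction D using Finset.induction_on generalizing χ with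
  | empty => simpa using hM χ (by simpa using hχ)
  | insert l D hl ih =>
    rw [Finset.prod_insert hl] at hχ ⊢
    have hD' : ∀ l ∈ D, l ∣ Fintype.card F - 1 := fun m hm => hD m (Finset.mem_insert_of_mem hm)
    obtain ⟨θ, rfl⟩ := exists_mulChar_orderOf_eq (hD l (Finset.mem_insert_self _ _))
    set n := orderOf θ with hn
    have hn0 : 0 < n := orderOf_pos θ
    have hnR : (1 : ℝ) ≤ n := by exact_mod_cast hn0
    have h0 : ∀ j, ‖sievedSum p D (χ * θ ^ j)‖ ≤ M * ∏ l ∈ D, (2 * (1 - 1 / (l : ℝ))) := by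
      refine fun j => ih hD' fun h => hχ ?_
      have h2 : ((χ * θ ^ j) ^ (∏ l ∈ D, l)) ^ n = χ ^ (n * ∏ l ∈ D, l) := by
        rw [← pow_mul, mul_comm _ n, mul_pow, ← pow_mul θ, mul_comm j, mul_assoc, pow_mul θ,
          pow_orderOf_eq_one, one_pow, mul_one]
      rw [← h2, h, one_pow]
    have h1 := h0 0
    rw [pow_zero, mul_one] at h1
    set B := M * ∏ l ∈ D, (2 * (1 - 1 / (l : ℝ))) with hB
    have h3 : ‖(1 - 1 / (n : ℂ))‖ = 1 - 1 / (n : ℝ) := by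
      have : (1 - 1 / (n : ℂ)) = ((1 - 1 / (n : ℝ) : ℝ) : ℂ) := by push_cast; rfl
      rw [this, Complex.norm_real, Real.norm_of_nonneg]
      rw [sub_nonneg, div_le_one (by linarith)]
      exact hnR
    have h4 : ‖(1 / (n : ℂ))‖ = 1 / (n : ℝ) := by simp
    rw [sievedSum_insert]
    refine (norm_sub_le _ _).trans ?_
    rw [norm_mul, norm_mul, h3, h4]
    have h5 := norm_sum_le_of_le (Finset.Ico 1 n) fun j _ => h0 j
    rw [Finset.sum_const, Nat.card_Ico, nsmul_eq_mul, Nat.cast_sub hn0, Nat.cast_one] at h5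
    have h6 : 0 ≤ 1 - 1 / (n : ℝ) := by rw [← h3]; exact norm_nonneg _
    calc _ ≤ (1 - 1 / (n : ℝ)) * B + 1 / (n : ℝ) * ((n - 1) * B) := by gcongr
      _ = _ := by
        rw [hB]
        field_simp
        ring

theorem Ncount_eq_sievedSum {F : Type*} [Field F] [Fintype F] (a b c : F) {t : ℕ} (ht : t ≠ 0)
    (k : ℕ) : (Ncount F a b c t k : ℂ)
      = sievedSum (fun x : F => ∃ y : F, y ≠ 0 ∧ y ^ k = a * x ^ 2 + b * x + c)
        t.primeFactors 1 := by
  have h1 : Ncount F a b c t k = (Finset.univ.filter fun x : F => IsTFree t x ∧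
      ∃ y : F, y ≠ 0 ∧ y ^ k = a * x ^ 2 + b * x + c).card := by
    rw [Ncount, Nat.card_eq_fintype_card]
    exact Fintype.card_subtype _
  rw [h1, sievedSum, Finset.card_filter, Nat.cast_sum, Finset.sum_filter]
  refine Finset.sum_congr rfl fun x _ => ?_
  rw [isTFree_iff ht]
  by_cases hx : x = 0
  · simp [hx, MulChar.map_zero]
  · rw [MulChar.one_apply (Ne.isUnit hx), Nat.cast_ite, Nat.cast_one, Nat.cast_zero]
    congr 1
    simp [hx, and_comm]

theorem Wnum_eq_two_pow {t : ℕ} (ht : t ≠ 0) : Wnum t = 2 ^ t.primeFactors.card := by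
  rw [Wnum, Finset.card_eq_sum_ones, Nat.sum_divisors_filter_squarefree ht (f := fun _ => 1),
    ← Finset.card_eq_sum_ones, Finset.card_powerset]
  congr 2
  ext p
  rw [Multiset.mem_toFinset, Nat.factors_eq]
  simp

theorem Ncount_difference_bound
    {F : Type*} [Field F] [Fintype F] {q k : ℕ} (hq : Fintype.card F = q) (hq5 : 5 ≤ q)
    (hk : 2 ≤ k) (hkdvd : k ∣ q - 1)
    (a b c : F) (ha : a ≠ 0) (hdisc : b ^ 2 - 4 * a * c ≠ 0)
    {t : ℕ} (ht0 : 0 < t) (htdvd : t ∣ q - 1)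
    {p : ℕ} (hp : p.Prime) (hpq : p ∣ q - 1) (hpt : ¬ p ∣ t) :
    |(Ncount F a b c (p * t) k : ℝ) - (1 - 1 / (p : ℝ)) * (Ncount F a b c t k : ℝ)|
      ≤ (Nat.totient (p * t) : ℝ) / ((p : ℝ) * (t : ℝ))
          * (2 * (Wnum t : ℝ) * Real.sqrt q) := by
  subst hq
  set f : F → Prop := fun x => ∃ y : F, y ≠ 0 ∧ y ^ k = a * x ^ 2 + b * x + c with hf
  set D := t.primeFactors with hD
  have hpD : p ∉ D := fun h => hpt (Nat.dvd_of_mem_primeFactors h)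
  have hpt0 : p * t ≠ 0 := mul_ne_zero hp.ne_zero ht0.ne'
  have hprime : (p * t).primeFactors = insert p D := by
    rw [Nat.primeFactors_mul hp.ne_zero ht0.ne', hp.primeFactors, ← Finset.insert_eq]
  have hbase : ∀ χ : MulChar F ℂ, χ ≠ 1 → ‖sievedSum f ∅ χ‖ ≤ 2 * √(Fintype.card F) :=
    fun χ hχ => norm_sievedSum_empty_le (by omega) ha hdisc hkdvd hχ
  obtain ⟨θ, hθ⟩ := exists_mulChar_orderOf_eq hpq
  set B : ℝ := 2 * √(Fintype.card F) * ∏ l ∈ D, (2 * (1 - 1 / (l : ℝ))) with hB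
  have hbound : ∀ j ∈ Finset.Ico 1 p, ‖sievedSum f D (1 * θ ^ j)‖ ≤ B := by
    intro j hj
    rw [Finset.mem_Ico] at hj
    refine norm_sievedSum_le hbase
      (fun l hl => (Nat.dvd_of_mem_primeFactors hl).trans htdvd) fun h => ?_
    rw [one_mul, ← pow_mul] at h
    have h1 := orderOf_dvd_of_pow_eq_one h
    rw [hθ, hp.dvd_mul] at h1
    rcases h1 with h1 | h1
    · exact absurd (Nat.le_of_dvd hj.1 h1) (by omega)
    · exact hpt (h1.trans (Nat.prod_primeFactors_dvd t))
  have hp0 : (0 : ℝ) < p := by exact_mod_cast hp.pos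
  have hdiff : (((Ncount F a b c (p * t) k : ℝ) - (1 - 1 / (p : ℝ)) * (Ncount F a b c t k : ℝ) : ℝ)
      : ℂ) = -(1 / (p : ℂ) * ∑ j ∈ Finset.Ico 1 p, sievedSum f D (1 * θ ^ j)) := by
    push_cast
    rw [Ncount_eq_sievedSum a b c hpt0, Ncount_eq_sievedSum a b c ht0.ne', hprime]
    have h := sievedSum_insert f D 1 θ
    rw [hθ] at h
    rw [h]
    ring
  have hle : |(Ncount F a b c (p * t) k : ℝ) - (1 - 1 / (p : ℝ)) * (Ncount F a b c t k : ℝ)|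
      ≤ 1 / (p : ℝ) * ((p - 1) * B) := by
    rw [← Real.norm_eq_abs, ← Complex.norm_real, hdiff, norm_neg, norm_mul]
    have h5 := norm_sum_le_of_le (Finset.Ico 1 p) hbound
    rw [Finset.sum_const, Nat.card_Ico, nsmul_eq_mul, Nat.cast_sub hp.pos, Nat.cast_one] at h5
    have h4 : ‖(1 / (p : ℂ))‖ = 1 / (p : ℝ) := by simp
    rw [h4]
    gcongr
  refine hle.trans (le_of_eq ?_)
  have htot : (Nat.totient (p * t) : ℝ)
      = p * t * ((1 - 1 / (p : ℝ)) * ∏ l ∈ D, (1 - 1 / (l : ℝ))) := by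
    have h := Nat.totient_eq_mul_prod_factors (p * t)
    rw [hprime, Finset.prod_insert hpD] at h
    have h' : ((Nat.totient (p * t) : ℚ) : ℝ) = _ := congrArg ((↑) : ℚ → ℝ) h
    push_cast at h'
    rw [h']
    simp only [one_div]
  have ht0' : (0 : ℝ) < t := by exact_mod_cast ht0
  rw [htot, Wnum_eq_two_pow ht0.ne', hB, Finset.prod_mul_distrib, Finset.prod_const]
  push_cast
  field_simp
  ring
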